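/- (Uniqueness of harmonic extensions modulo O(Q^k); flat-model version of the uniqueness assertion in the paper's Proposition 'harm'.) Let k ≥ 1 be an integer and let f̃₁ and f̃₂ be smooth functions on ℝ^N ∖ {0}, both homogeneous of weight k − n/2, such that f̃₁ − f̃₂ is O(Q), Δ f̃₁ is O(Q^{k−1}), and Δ f̃₂ is O(Q^{k−1}). Then f̃₁ − f̃₂ is O(Q^k). -/

import Mathlib

open scoped BigOperators

/-- Partial derivative in the `A`-th coordinate direction. -/
noncomputable def pd {N : ℕ} (A : Fin N) (f : (Fin N → ℝ) → ℝ) : (Fin N → ℝ) → ℝ :=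
  fun x => fderiv ℝ f x (Pi.single A 1)

/-- Ambient Laplacian `Δf = ∑_{A,B} h^{AB} ∂_A ∂_B f` w.r.t. the inverse metric `hInv`. -/
noncomputable def lap {N : ℕ} (hInv : Matrix (Fin N) (Fin N) ℝ)
    (f : (Fin N → ℝ) → ℝ) : (Fin N → ℝ) → ℝ :=
  fun x => ∑ A : Fin N, ∑ B : Fin N, hInv A B * pd A (pd B f) x

/-- `X_A(x) = ∑_B h_{AB} x^B`. -/
def Xc {N : ℕ} (h : Matrix (Fin N) (Fin N) ℝ) (A : Fin N) : (Fin N → ℝ) → ℝ :=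
  fun x => ∑ B : Fin N, h A B * x B

/-- `Q(x) = ∑_{A,B} h_{AB} x^A x^B`. -/
def Qfun {N : ℕ} (h : Matrix (Fin N) (Fin N) ℝ) : (Fin N → ℝ) → ℝ :=
  fun x => ∑ A : Fin N, ∑ B : Fin N, h A B * x A * x B

/-- Smooth (C^∞) on `ℝ^N ∖ {0}`. -/
def SmoothOffZero {N : ℕ} (f : (Fin N → ℝ) → ℝ) : Prop :=
  ContDiffOn ℝ (⊤ : ℕ∞) f {x : Fin N → ℝ | x ≠ 0}

/-- Homogeneous of weight `w` on `ℝ^N ∖ {0}`. -/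
def Homog {N : ℕ} (w : ℝ) (f : (Fin N → ℝ) → ℝ) : Prop :=
  ∀ x : Fin N → ℝ, x ≠ 0 → (∑ A : Fin N, x A * pd A f x) = w * f x

/-- Ambient tractor-D operator at weight `w`: `(D^{(w)} f)_A = (n+2w−2)∂_A f − X_A Δf`. -/
noncomputable def Dop {N : ℕ} (n : ℕ) (h hInv : Matrix (Fin N) (Fin N) ℝ) (w : ℝ)
    (f : (Fin N → ℝ) → ℝ) (A : Fin N) : (Fin N → ℝ) → ℝ :=
  fun x => ((n : ℝ) + 2 * w - 2) * pd A f x - Xc h A x * lap hInv f x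

/-- Iterated tractor-D: `seqD … w0 f A 0 = f` and
`seqD … w0 f A (j+1) = (D^{(w0−j)} (seqD … w0 f A j))_{A (j+1)}`. -/
noncomputable def seqD {N : ℕ} (n : ℕ) (h hInv : Matrix (Fin N) (Fin N) ℝ)
    (w0 : ℝ) (f : (Fin N → ℝ) → ℝ) (A : ℕ → Fin N) : ℕ → (Fin N → ℝ) → ℝ
  | 0 => f
  | j + 1 => Dop n h hInv (w0 - (j : ℝ)) (seqD n h hInv w0 f A j) (A (j + 1))

/-- `u` is `O(Q^m)`: `u = Q^m · g` for some smooth `g` on `ℝ^N ∖ {0}`. -/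
def BigOQ {N : ℕ} (h : Matrix (Fin N) (Fin N) ℝ) (m : ℕ) (u : (Fin N → ℝ) → ℝ) : Prop :=
  ∃ g : (Fin N → ℝ) → ℝ, SmoothOffZero g ∧
    ∀ x : Fin N → ℝ, x ≠ 0 → u x = (Qfun h x) ^ m * g x

open scoped Topology

section Coordinates

variable {N : ℕ}

theorem SmoothOffZero.contDiffAt {f : (Fin N → ℝ) → ℝ} (hf : SmoothOffZero f)
    {x : Fin N → ℝ} (hx : x ≠ 0) : ContDiffAt ℝ (⊤ : ℕ∞) f x :=
  ContDiffOn.contDiffAt hf (isOpen_ne.mem_nhds hx)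

theorem SmoothOffZero.differentiableAt {f : (Fin N → ℝ) → ℝ} (hf : SmoothOffZero f)
    {x : Fin N → ℝ} (hx : x ≠ 0) : DifferentiableAt ℝ f x :=
  (hf.contDiffAt hx).differentiableAt (by simp)

theorem SmoothOffZero.pd {f : (Fin N → ℝ) → ℝ} (hf : SmoothOffZero f) (A : Fin N) :
    SmoothOffZero (pd A f) := by
  have hd : ContDiffOn ℝ (⊤ : ℕ∞) (fderiv ℝ f) {x : Fin N → ℝ | x ≠ 0} :=
    hf.fderiv_of_isOpen isOpen_ne (by simp)
  exact hd.clm_apply contDiffOn_const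

theorem SmoothOffZero.lap {f : (Fin N → ℝ) → ℝ} (hf : SmoothOffZero f)
    (hInv : Matrix (Fin N) (Fin N) ℝ) : SmoothOffZero (lap hInv f) :=
  ContDiffOn.sum fun A _ => ContDiffOn.sum fun B _ =>
    contDiffOn_const.mul ((hf.pd B).pd A)

theorem pd_congr {f g : (Fin N → ℝ) → ℝ} {x : Fin N → ℝ} (hfg : f =ᶠ[𝓝 x] g) (A : Fin N) :
    pd A f x = pd A g x := by
  simp only [pd, hfg.fderiv_eq]

theorem pd_add {f g : (Fin N → ℝ) → ℝ} {x : Fin N → ℝ} (hf : DifferentiableAt ℝ f x)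
    (hg : DifferentiableAt ℝ g x) (A : Fin N) :
    pd A (fun y => f y + g y) x = pd A f x + pd A g x := by
  simp [pd, fderiv_fun_add hf hg]

theorem pd_sub {f g : (Fin N → ℝ) → ℝ} {x : Fin N → ℝ} (hf : DifferentiableAt ℝ f x)
    (hg : DifferentiableAt ℝ g x) (A : Fin N) :
    pd A (fun y => f y - g y) x = pd A f x - pd A g x := by
  simp [pd, fderiv_fun_sub hf hg]

theorem pd_mul {f g : (Fin N → ℝ) → ℝ} {x : Fin N → ℝ} (hf : DifferentiableAt ℝ f x)
    (hg : DifferentiableAt ℝ g x) (A : Fin N) :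
    pd A (fun y => f y * g y) x = pd A f x * g x + f x * pd A g x := by
  simp [pd, fderiv_fun_mul hf hg]
  ring

theorem pd_pd_congr {f g : (Fin N → ℝ) → ℝ} (hfg : ∀ y, y ≠ 0 → f y = g y)
    {x : Fin N → ℝ} (hx : x ≠ 0) (A B : Fin N) : pd A (pd B f) x = pd A (pd B g) x := by
  refine pd_congr ?_ A
  filter_upwards [isOpen_ne.mem_nhds hx] with y hy
  refine pd_congr ?_ B
  filter_upwards [isOpen_ne.mem_nhds hy] with z hz using hfg z hz

theorem lap_congr {f g : (Fin N → ℝ) → ℝ} (hfg : ∀ y, y ≠ 0 → f y = g y)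
    (hInv : Matrix (Fin N) (Fin N) ℝ) {x : Fin N → ℝ} (hx : x ≠ 0) :
    lap hInv f x = lap hInv g x := by
  simp only [lap, pd_pd_congr hfg hx]

theorem lap_sub {f g : (Fin N → ℝ) → ℝ} (hf : SmoothOffZero f) (hg : SmoothOffZero g)
    (hInv : Matrix (Fin N) (Fin N) ℝ) {x : Fin N → ℝ} (hx : x ≠ 0) :
    lap hInv (fun y => f y - g y) x = lap hInv f x - lap hInv g x := by
  have key (A B : Fin N) :
      pd A (pd B fun y => f y - g y) x = pd A (pd B f) x - pd A (pd B g) x := by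
    rw [← pd_sub ((hf.pd B).differentiableAt hx) ((hg.pd B).differentiableAt hx)]
    refine pd_congr ?_ A
    filter_upwards [isOpen_ne.mem_nhds hx] with y hy
    exact pd_sub (hf.differentiableAt hy) (hg.differentiableAt hy) B
  simp only [lap, key, mul_sub, Finset.sum_sub_distrib]

theorem pd_pd_mul {f g : (Fin N → ℝ) → ℝ} (hf : SmoothOffZero f) (hg : SmoothOffZero g)
    {x : Fin N → ℝ} (hx : x ≠ 0) (A B : Fin N) :
    pd A (pd B fun y => f y * g y) x =
      pd A (pd B f) x * g x + pd B f x * pd A g x + pd A f x * pd B g x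
        + f x * pd A (pd B g) x := by
  have hf' := hf.differentiableAt hx
  have hg' := hg.differentiableAt hx
  have hfB := (hf.pd B).differentiableAt hx
  have hgB := (hg.pd B).differentiableAt hx
  have heq : pd A (pd B fun y => f y * g y) x
      = pd A (fun y => pd B f y * g y + f y * pd B g y) x := by
    refine pd_congr ?_ A
    filter_upwards [isOpen_ne.mem_nhds hx] with y hy
    exact pd_mul (hf.differentiableAt hy) (hg.differentiableAt hy) B
  rw [heq, pd_add (hfB.fun_mul hg') (hf'.fun_mul hgB), pd_mul hfB hg', pd_mul hf' hgB]
  ring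

theorem Homog.sub {w : ℝ} {f g : (Fin N → ℝ) → ℝ} (hf : Homog w f) (hg : Homog w g)
    (hfs : SmoothOffZero f) (hgs : SmoothOffZero g) : Homog w (fun y => f y - g y) := by
  intro x hx
  simp only [pd_sub (hfs.differentiableAt hx) (hgs.differentiableAt hx), mul_sub,
    Finset.sum_sub_distrib, hf x hx, hg x hx]

end Coordinates

theorem natCast_mul_pow_pred_mul (m : ℕ) (q : ℝ) : (m : ℝ) * q ^ (m - 1) * q = m * q ^ m := by
  cases m with
  | zero => simp
  | succ m => rw [Nat.add_sub_cancel]; ring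

section Quadric

variable {N : ℕ} (h : Matrix (Fin N) (Fin N) ℝ)

theorem Qfun_eq_sum_Xc (x : Fin N → ℝ) : Qfun h x = ∑ A, x A * Xc h A x := by
  simp only [Qfun, Xc, Finset.mul_sum]
  exact Finset.sum_congr rfl fun A _ => Finset.sum_congr rfl fun B _ => by ring

theorem contDiff_Xc (A : Fin N) : ContDiff ℝ (⊤ : ℕ∞) (Xc h A) := by
  unfold Xc; fun_prop

theorem contDiff_Qfun : ContDiff ℝ (⊤ : ℕ∞) (Qfun h) := by
  unfold Qfun; fun_prop

theorem pd_Xc (A B : Fin N) (x : Fin N → ℝ) : pd A (Xc h B) x = h B A := by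
  have hd : HasFDerivAt (Xc h B)
      (∑ C, h B C • ContinuousLinearMap.proj (R := ℝ) (φ := fun _ : Fin N => ℝ) C) x :=
    HasFDerivAt.fun_sum fun C _ => (hasFDerivAt_apply C x).const_mul (h B C)
  simp [pd, hd.fderiv, Pi.single_apply]

theorem pd_Qfun (hSymm : ∀ A B, h A B = h B A) (A : Fin N) (x : Fin N → ℝ) :
    pd A (Qfun h) x = 2 * Xc h A x := by
  have hd : HasFDerivAt (Qfun h) (∑ B, (x B • fderiv ℝ (Xc h B) x
      + Xc h B x • ContinuousLinearMap.proj (R := ℝ) (φ := fun _ : Fin N => ℝ) B)) x := by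
    rw [show Qfun h = fun y => ∑ B, y B * Xc h B y from funext (Qfun_eq_sum_Xc h)]
    exact HasFDerivAt.fun_sum fun B _ => (hasFDerivAt_apply B x).mul
      ((contDiff_Xc h B).differentiable (by simp) x).hasFDerivAt
  have hX (B : Fin N) : fderiv ℝ (Xc h B) x (Pi.single A 1) = h B A := pd_Xc h A B x
  simp only [pd, hd.fderiv, sum_apply, add_apply,
    smul_apply, hX, ContinuousLinearMap.proj_apply, smul_eq_mul,
    Finset.sum_add_distrib]
  simp only [Pi.single_apply, mul_ite, mul_one, mul_zero, Finset.sum_ite_eq', Finset.mem_univ,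
    if_true]
  have : ∑ B, x B * h B A = Xc h A x :=
    Finset.sum_congr rfl fun B _ => by rw [hSymm B A, mul_comm]
  rw [this]; ring

theorem pd_Qfun_pow (hSymm : ∀ A B, h A B = h B A) (m : ℕ) (A : Fin N) (x : Fin N → ℝ) :
    pd A (fun y => Qfun h y ^ m) x = 2 * m * Qfun h x ^ (m - 1) * Xc h A x := by
  have hQ : DifferentiableAt ℝ (Qfun h) x := (contDiff_Qfun h).differentiable (by simp) x
  have := pd_Qfun h hSymm A x
  simp only [pd] at this ⊢
  rw [fderiv_fun_pow m hQ]
  simp [this]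
  ring

theorem pd_pd_Qfun_pow (hSymm : ∀ A B, h A B = h B A) (m : ℕ) (A B : Fin N) (x : Fin N → ℝ) :
    pd A (pd B fun y => Qfun h y ^ (m + 1)) x =
      2 * (m + 1) * (Qfun h x ^ m * h B A
        + 2 * m * Qfun h x ^ (m - 1) * (Xc h A x * Xc h B x)) := by
  have hQ : DifferentiableAt ℝ (fun y => Qfun h y ^ m) x :=
    ((contDiff_Qfun h).pow m).differentiable (by simp) x
  have hX : DifferentiableAt ℝ (Xc h B) x := (contDiff_Xc h B).differentiable (by simp) x
  have hfun : (pd B fun y => Qfun h y ^ (m + 1))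
      = fun y => (fun _ => 2 * ((m : ℝ) + 1)) y * (Qfun h y ^ m * Xc h B y) := by
    funext y
    rw [pd_Qfun_pow h hSymm]
    push_cast [Nat.add_sub_cancel]
    ring
  rw [hfun, pd_mul (differentiableAt_const _) (hQ.fun_mul hX), pd_mul hQ hX,
    pd_Qfun_pow h hSymm, pd_Xc]
  simp only [pd, fderiv_fun_const, Pi.zero_apply, zero_apply]
  ring

variable {h} {hInv : Matrix (Fin N) (Fin N) ℝ}

theorem sum_hInv_mul_Xc (hInvh : h * hInv = 1) (A : Fin N) (x : Fin N → ℝ) :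
    ∑ B, hInv A B * Xc h B x = x A := by
  have h1 : hInv * h = 1 := mul_eq_one_comm.mp hInvh
  have : hInv.mulVec (h.mulVec x) = x := by rw [Matrix.mulVec_mulVec, h1, Matrix.one_mulVec]
  exact congrFun this A

theorem hInv_symm (hSymm : ∀ A B, h A B = h B A) (hInvh : h * hInv = 1) (A B : Fin N) :
    hInv A B = hInv B A := by
  have hT : h.transpose = h := Matrix.ext fun A B => hSymm B A
  have h2 : hInv.transpose * h = 1 := by
    rw [← hT, ← Matrix.transpose_mul, hInvh, Matrix.transpose_one]
  have : hInv.transpose = hInv := left_inv_eq_right_inv h2 hInvh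
  exact congrFun (congrFun this B) A

/-- Contraction of a covector with `X`. -/
theorem sum_hInv_Xc_mul (hInvh : h * hInv = 1) (x v : Fin N → ℝ) :
    ∑ A, ∑ B, hInv A B * (Xc h B x * v A) = ∑ A, x A * v A := by
  refine Finset.sum_congr rfl fun A _ => ?_
  rw [← sum_hInv_mul_Xc hInvh A x, Finset.sum_mul]
  exact Finset.sum_congr rfl fun B _ => by ring

theorem sum_hInv_Xc_mul_right (hSymm : ∀ A B, h A B = h B A) (hInvh : h * hInv = 1)
    (x v : Fin N → ℝ) :
    ∑ A, ∑ B, hInv A B * (Xc h A x * v B) = ∑ A, x A * v A := by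
  rw [Finset.sum_comm, ← sum_hInv_Xc_mul hInvh]
  exact Finset.sum_congr rfl fun A _ => Finset.sum_congr rfl fun B _ => by
    rw [hInv_symm hSymm hInvh]

theorem sum_hInv_mul_h (hInvh : h * hInv = 1) : ∑ A, ∑ B, hInv A B * h B A = N := by
  have h1 : hInv * h = 1 := mul_eq_one_comm.mp hInvh
  have : (hInv * h).trace = N := by rw [h1]; simp
  simpa [Matrix.trace, Matrix.mul_apply] using this

theorem lap_Qfun_pow_mul (hSymm : ∀ A B, h A B = h B A) (hInvh : h * hInv = 1) (m : ℕ)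
    {g : (Fin N → ℝ) → ℝ} (hg : SmoothOffZero g) {x : Fin N → ℝ} (hx : x ≠ 0) :
    lap hInv (fun y => Qfun h y ^ (m + 1) * g y) x =
      Qfun h x ^ m * (2 * (m + 1) * ((N + 2 * m) * g x + 2 * ∑ A, x A * pd A g x)
        + Qfun h x * lap hInv g x) := by
  have hQ : SmoothOffZero fun y => Qfun h y ^ (m + 1) :=
    ((contDiff_Qfun h).pow (m + 1)).contDiffOn
  have hterm (A B : Fin N) : hInv A B * pd A (pd B fun y => Qfun h y ^ (m + 1) * g y) x =
      2 * (m + 1) * Qfun h x ^ m * g x * (hInv A B * h B A)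
      + 2 * (m + 1) * (2 * m * Qfun h x ^ (m - 1)) * g x * (hInv A B * (Xc h B x * Xc h A x))
      + 2 * (m + 1) * Qfun h x ^ m * (hInv A B * (Xc h B x * pd A g x))
      + 2 * (m + 1) * Qfun h x ^ m * (hInv A B * (Xc h A x * pd B g x))
      + Qfun h x ^ (m + 1) * (hInv A B * pd A (pd B g) x) := by
    rw [pd_pd_mul hQ hg hx, pd_pd_Qfun_pow h hSymm, pd_Qfun_pow h hSymm, pd_Qfun_pow h hSymm,
      Nat.add_sub_cancel]
    push_cast
    ring
  rw [lap]
  simp only [hterm, Finset.sum_add_distrib, ← Finset.mul_sum]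
  rw [sum_hInv_mul_h hInvh, sum_hInv_Xc_mul hInvh x (fun A => Xc h A x),
    sum_hInv_Xc_mul hInvh x (fun A => pd A g x),
    sum_hInv_Xc_mul_right hSymm hInvh x (fun A => pd A g x), ← Qfun_eq_sum_Xc, lap]
  linear_combination 4 * ((m : ℝ) + 1) * g x * natCast_mul_pow_pred_mul m (Qfun h x)

/-- Euler's relation for a quotient by a power of `Q`, away from the null cone. -/
theorem euler_of_Qfun_pow_mul (hSymm : ∀ A B, h A B = h B A) (m : ℕ) {w : ℝ}
    {u g : (Fin N → ℝ) → ℝ} (hu : Homog w u) (hg : SmoothOffZero g)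
    (hug : ∀ y, y ≠ 0 → u y = Qfun h y ^ m * g y) {x : Fin N → ℝ} (hx : x ≠ 0)
    (hQx : Qfun h x ≠ 0) : ∑ A, x A * pd A g x = (w - 2 * m) * g x := by
  have hQ : DifferentiableAt ℝ (fun y => Qfun h y ^ m) x :=
    ((contDiff_Qfun h).pow m).differentiable (by simp) x
  have hterm (A : Fin N) : x A * pd A u x =
      2 * m * Qfun h x ^ (m - 1) * g x * (x A * Xc h A x)
        + Qfun h x ^ m * (x A * pd A g x) := by
    have : u =ᶠ[𝓝 x] fun y => Qfun h y ^ m * g y := by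
      filter_upwards [isOpen_ne.mem_nhds hx] with y hy using hug y hy
    rw [pd_congr this, pd_mul hQ (hg.differentiableAt hx), pd_Qfun_pow h hSymm]
    ring
  have he := hu x hx
  simp only [hterm, Finset.sum_add_distrib, ← Finset.mul_sum] at he
  rw [← Qfun_eq_sum_Xc, hug x hx] at he
  refine mul_left_cancel₀ (pow_ne_zero m hQx) ?_
  linear_combination he - 2 * g x * natCast_mul_pow_pred_mul m (Qfun h x)

/-- The order of vanishing along the null cone improves by one as long as it is below `k`. -/
theorem BigOQ.succ_of_lap {n : ℕ} {h hInv : Matrix (Fin (n + 2)) (Fin (n + 2)) ℝ}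
    (hSymm : ∀ A B, h A B = h B A) (hInvh : h * hInv = 1) {k m : ℕ} (hm : m + 1 < k)
    {u : (Fin (n + 2) → ℝ) → ℝ} (hu : Homog ((k : ℝ) - (n : ℝ) / 2) u)
    (hlap : BigOQ h (k - 1) (lap hInv u)) (hO : BigOQ h (m + 1) u) :
    BigOQ h (m + 2) u := by
  obtain ⟨g, hg, hug⟩ := hO
  obtain ⟨r, hr, hlr⟩ := hlap
  obtain ⟨l, rfl⟩ : ∃ l, k = m + 2 + l := ⟨k - (m + 2), by omega⟩
  have hc : (4 * ((m : ℝ) + 1) * (l + 1)) ≠ 0 := by positivity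
  refine ⟨fun y => (4 * ((m : ℝ) + 1) * (l + 1))⁻¹ * (Qfun h y ^ l * r y - lap hInv g y), ?_, ?_⟩
  · exact contDiffOn_const.mul
      ((((contDiff_Qfun h).pow l).contDiffOn.mul hr).sub (hg.lap hInv))
  intro x hx
  by_cases hQx : Qfun h x = 0
  · simp [hug x hx, hQx]
  have hE := euler_of_Qfun_pow_mul hSymm (m + 1) hu hg hug hx hQx
  have hL := lap_Qfun_pow_mul hSymm hInvh m hg hx
  rw [← lap_congr hug hInv hx, hlr x hx, hE, show m + 2 + l - 1 = m + (l + 1) by omega,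
    pow_add, mul_assoc] at hL
  have hL' := mul_left_cancel₀ (pow_ne_zero m hQx) hL
  push_cast at hL'
  rw [hug x hx]
  field_simp
  linear_combination (-Qfun h x ^ (m + 1)) * hL'

end Quadric

/-- uniqueness of harmonic extensions modulo `O(Q^k)`:
if `f̃₁, f̃₂` are smooth, homogeneous of weight `k − n/2`, with `f̃₁ − f̃₂ = O(Q)` and
`Δ f̃ᵢ = O(Q^{k−1})`, then `f̃₁ − f̃₂ = O(Q^k)`. -/
theorem harmonic_extension_unique
    (n : ℕ) (hn : 1 ≤ n)
    (h hInv : Matrix (Fin (n + 2)) (Fin (n + 2)) ℝ)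
    (hSymm : ∀ A B, h A B = h B A) (hInvh : h * hInv = 1)
    (k : ℕ) (hk : 1 ≤ k)
    (ft₁ ft₂ : (Fin (n + 2) → ℝ) → ℝ)
    (hft₁ : SmoothOffZero ft₁) (hft₂ : SmoothOffZero ft₂)
    (hhom₁ : Homog ((k : ℝ) - (n : ℝ) / 2) ft₁)
    (hhom₂ : Homog ((k : ℝ) - (n : ℝ) / 2) ft₂)
    (hdiff : BigOQ h 1 (fun y => ft₁ y - ft₂ y))
    (hlap₁ : BigOQ h (k - 1) (lap hInv ft₁))
    (hlap₂ : BigOQ h (k - 1) (lap hInv ft₂)) :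
    BigOQ h k (fun y => ft₁ y - ft₂ y) := by
  have hu := hhom₁.sub hhom₂ hft₁ hft₂
  have hlap : BigOQ h (k - 1) (lap hInv fun y => ft₁ y - ft₂ y) := by
    obtain ⟨r₁, hr₁, h₁⟩ := hlap₁
    obtain ⟨r₂, hr₂, h₂⟩ := hlap₂
    refine ⟨fun y => r₁ y - r₂ y, hr₁.sub hr₂, fun x hx => ?_⟩
    rw [lap_sub hft₁ hft₂ hInv hx, h₁ x hx, h₂ x hx, mul_sub]
  have hO (m : ℕ) : m + 1 ≤ k → BigOQ h (m + 1) (fun y => ft₁ y - ft₂ y) := by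
    induction m with
    | zero => exact fun _ => hdiff
    | succ m ih => exact fun hm => BigOQ.succ_of_lap hSymm hInvh (by omega) hu hlap (ih (by omega))
  obtain ⟨m, rfl⟩ : ∃ m, k = m + 1 := ⟨k - 1, by omega⟩
  exact hO m le_rfl
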